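/- arXiv:1512.00363 — 3 statements merged into one kernel-verified Lean document; each statement's English description precedes it below -/
import Mathlib

section
/- Let G be a simple graph with vertex set V and let P = (V_{u,v} | (u,v) ∈ V × V) be a simple T-partition system on G. If * is a binary operation on V such that for all u, v ∈ V, v ∈ V_{u, u*v}, then (V,*) is a simple travel groupoid on G. -/
variable {V : Type*}

/-- The right translation system of a groupoid `(V, op)`:
`rts op u v = {w ∈ V | u * w = v}`. -/
def rts (op : V → V → V) (u v : V) : Set V := {w | op u w = v}

/-- Axiom (t1): `(u * v) * u = u` for all `u, v`. -/
def T1 (op : V → V → V) : Prop := ∀ u v : V, op (op u v) u = u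

/-- Axiom (t2): if `(u * v) * v = u` then `u = v`. -/
def T2 (op : V → V → V) : Prop := ∀ u v : V, op (op u v) v = u → u = v

/-- A travel groupoid: a groupoid satisfying (t1) and (t2). -/
def IsTravelGroupoid (op : V → V → V) : Prop := T1 op ∧ T2 op

/-- Axiom (t3) (simple): if `v * u ≠ u` then `u * (v * u) = u * v`. -/
def T3 (op : V → V → V) : Prop := ∀ u v : V, op v u ≠ u → op u (op v u) = op u v

/-- Axiom (t4) (smooth): if `u * v = u * w` then `u * (v * w) = u * v`. -/
def T4 (op : V → V → V) : Prop := ∀ u v w : V, op u v = op u w → op u (op v w) = op u v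

/-- Axiom (t5) (semi-smooth): if `u * v = u * w` then
`u * (v * w) = u * v` or `u * ((v * w) * w) = u * v`. -/
def T5 (op : V → V → V) : Prop :=
  ∀ u v w : V, op u v = op u w →
    op u (op v w) = op u v ∨ op u (op (op v w) w) = op u v

/-- A travel groupoid `(V, op)` is on the graph `G` if the edges of `G` are exactly
the pairs `{u, v}` with `u ≠ v` and `u * v = v`. -/
def IsOnGraph (op : V → V → V) (G : SimpleGraph V) : Prop :=
  ∀ u v : V, G.Adj u v ↔ u ≠ v ∧ op u v = v

/-- The closed neighborhood `N_G[u]` of a vertex `u` in a graph `G`. -/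
def closedNbhd (G : SimpleGraph V) (u : V) : Set V := insert u (G.neighborSet u)

/-- A T-partition system on a graph `G`: a family `P u v ⊆ V` indexed by pairs of
vertices satisfying (P0) (stated as: the sets `P u v` for `v ∈ N_G[u]` cover `V`
and are pairwise disjoint), (P1a), (P1b), (P1c), and (P2). -/
structure IsTPartitionSystem (G : SimpleGraph V) (P : V → V → Set V) : Prop where
  cover : ∀ u a : V, ∃ v ∈ closedNbhd G u, a ∈ P u v
  pairwise_disjoint : ∀ u : V, ∀ v ∈ closedNbhd G u, ∀ w ∈ closedNbhd G u,
    v ≠ w → P u v ∩ P u w = ∅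
  p1a : ∀ u : V, P u u = {u}
  p1b : ∀ u v : V, u ≠ v → (v ∈ P u v ↔ G.Adj u v)
  p1c : ∀ u v : V, u ≠ v → (P u v = ∅ ↔ ¬ G.Adj u v)
  p2 : ∀ u v : V, u ≠ v → P u v ∩ P v u = ∅

/-- Property (R3) (simple T-partition system). -/
def R3 (P : V → V → Set V) : Prop :=
  ∀ u v x y : V, u ∈ P v x → v ∈ P u y → u ≠ x → v ≠ y → x ∈ P u y ∧ y ∈ P v x

/-- Property (R4) (smooth T-partition system). -/
def R4 (P : V → V → Set V) : Prop :=
  ∀ u v x y z : V, x ∈ P u v → y ∈ P u v → y ∈ P x z → z ∈ P u v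

/-- Property (R5) (semi-smooth T-partition system). -/
def R5 (P : V → V → Set V) : Prop :=
  ∀ u v x y z w : V, x ∈ P u v → y ∈ P u v → y ∈ P x z ∩ P z w →
    z ∈ P u v ∨ w ∈ P u v

/-- In a T-partition system, a nonempty part `P u v` has `v` in the closed neighborhood of `u`. -/
theorem IsTPartitionSystem.mem_closedNbhd {G : SimpleGraph V} {P : V → V → Set V}
    (hP : IsTPartitionSystem G P) {u v w : V} (h : w ∈ P u v) : v ∈ closedNbhd G u := by
  by_cases huv : u = v
  · exact Or.inl huv.symm
  · refine Or.inr ?_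
    by_contra hadj
    have hempty := (hP.p1c u v huv).2 hadj
    simp [hempty] at h

/-- Each vertex lies in exactly one part `P u v` for fixed `u`. -/
theorem IsTPartitionSystem.eq_of_mem {G : SimpleGraph V} {P : V → V → Set V}
    (hP : IsTPartitionSystem G P) {u v v' w : V} (h : w ∈ P u v) (h' : w ∈ P u v') : v = v' := by
  by_contra hne
  have hdisj := hP.pairwise_disjoint u v (hP.mem_closedNbhd h) v' (hP.mem_closedNbhd h') hne
  exact hdisj.le ⟨h, h'⟩

theorem stmt7 [Nonempty V] (G : SimpleGraph V) (P : V → V → Set V)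
    (hP : IsTPartitionSystem G P) (hR3 : R3 P) (op : V → V → V)
    (hop : ∀ u v : V, v ∈ P u (op u v)) :
    (IsTravelGroupoid op ∧ T3 op) ∧ IsOnGraph op G := by
  have mem_iff : ∀ u v w : V, w ∈ P u v ↔ op u w = v := fun u v w =>
    ⟨fun h => hP.eq_of_mem (hop u w) h, fun h => h ▸ hop u w⟩
  have op_self : ∀ u : V, op u u = u := fun u => (mem_iff u u u).1 (by simp [hP.p1a])
  have onGraph : IsOnGraph op G := by
    intro u v
    constructor
    · intro h
      exact ⟨h.ne, (mem_iff u v v).1 ((hP.p1b u v h.ne).2 h)⟩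
    · rintro ⟨hne, h⟩
      exact (hP.p1b u v hne).1 ((mem_iff u v v).2 h)
  refine ⟨⟨⟨?_, ?_⟩, ?_⟩, onGraph⟩
  · intro u v
    rcases hP.mem_closedNbhd (hop u v) with h | h
    · rw [h, op_self]
    · exact ((onGraph _ _).1 (SimpleGraph.Adj.symm h)).2
  · intro u v h
    by_cases hw : u = op u v
    · have hv := hop u v
      rw [← hw, hP.p1a] at hv
      exact hv.symm
    · exact ((hP.p2 u (op u v) hw).le ⟨hop u v, (mem_iff _ _ _).2 h⟩).elim
  · intro u v h
    have huv : u ≠ v := by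
      rintro rfl
      exact h (op_self u)
    have hne : v ≠ op u v := fun hv =>
      h ((onGraph v u).1 ((onGraph u v).2 ⟨huv, hv.symm⟩).symm).2
    exact (mem_iff _ _ _).1 (hR3 u v _ _ (hop v u) (hop u v) h.symm hne).1
end

section
/- Let G be a simple graph with vertex set V. Then the map sending a simple travel groupoid (V,*) on G to its right translation system is a bijection between the set of all simple travel groupoids on G and the set of all simple T-partition systems on G. -/
variable {V : Type*}

theorem mem_rts {op : V → V → V} {u v w : V} : w ∈ rts op u v ↔ op u w = v := Iff.rfl

theorem rts_injective : Function.Injective (rts : (V → V → V) → V → V → Set V) := by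
  intro op op' h
  funext u w
  have hw : w ∈ rts op u (op u w) := rfl
  rw [h] at hw
  exact hw.symm

namespace IsTravelGroupoid

variable {op : V → V → V}

theorem op_self (h : IsTravelGroupoid op) (u : V) : op u u = u :=
  h.2 _ u (congrArg (op · u) (h.1 u u))

theorem op_op_left (h : IsTravelGroupoid op) (u v : V) : op u (op u v) = op u v := by
  simpa only [h.1 u v] using h.1 (op u v) u

theorem op_eq_left_iff (h : IsTravelGroupoid op) {u v : V} : op u v = u ↔ v = u := by
  refine ⟨fun huv => (h.2 u v ?_).symm, ?_⟩
  · rw [huv, huv]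
  · rintro rfl
    exact h.op_self v

theorem isTPartitionSystem_rts {G : SimpleGraph V} (h : IsTravelGroupoid op)
    (hG : IsOnGraph op G) : IsTPartitionSystem G (rts op) where
  cover u a := by
    refine ⟨op u a, ?_, rfl⟩
    by_cases hu : op u a = u
    · exact Or.inl hu
    · exact Or.inr ((hG u _).2 ⟨Ne.symm hu, h.op_op_left u a⟩)
  pairwise_disjoint u v _ w _ hvw :=
    Set.eq_empty_of_forall_notMem fun _ ha => hvw (ha.1.symm.trans ha.2)
  p1a u := Set.ext fun _ => h.op_eq_left_iff
  p1b u v huv := by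
    rw [mem_rts, hG]
    exact (and_iff_right huv).symm
  p1c u v huv := by
    rw [← not_iff_not, not_not, ← Ne, ← Set.nonempty_iff_ne_empty, hG]
    refine ⟨?_, fun hv => ⟨v, hv.2⟩⟩
    rintro ⟨w, rfl⟩
    exact ⟨huv, h.op_op_left u w⟩
  p2 u v huv := by
    refine Set.eq_empty_of_forall_notMem fun w ⟨hw, hw'⟩ => huv ?_
    rw [mem_rts] at hw hw'
    obtain rfl : u = w := h.2 u w (by rw [hw, hw'])
    exact (h.op_self u).symm.trans hw

end IsTravelGroupoid

theorem T3.r3_rts {op : V → V → V} (h : T3 op) : R3 (rts op) := by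
  rintro u v _ _ rfl rfl hu hv
  exact ⟨h u v hu.symm, h v u hv.symm⟩

theorem IsTravelGroupoid.t3_of_r3_rts {op : V → V → V} {G : SimpleGraph V}
    (h : IsTravelGroupoid op) (hG : IsOnGraph op G) (hR : R3 (rts op)) : T3 op := by
  intro u v hvu
  have huv : u ≠ v := by
    rintro rfl
    exact hvu (h.op_self u)
  refine (hR u v _ _ rfl rfl hvu.symm fun hv => hvu ?_).1
  exact ((hG v u).1 ((hG u v).2 ⟨huv, hv.symm⟩).symm).2

namespace IsTPartitionSystem

variable {G : SimpleGraph V} {P : V → V → Set V}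

theorem mem_closedNbhd_s9 (h : IsTPartitionSystem G P) {u v a : V} (ha : a ∈ P u v) :
    v ∈ closedNbhd G u := by
  by_cases huv : u = v
  · exact Or.inl huv.symm
  · refine Or.inr (not_not.1 fun hadj => ?_)
    rw [(h.p1c u v huv).2 hadj] at ha
    exact ha

theorem eq_of_mem_s9 (h : IsTPartitionSystem G P) {u v w a : V} (hv : a ∈ P u v)
    (hw : a ∈ P u w) : v = w := by
  by_contra hvw
  exact (h.pairwise_disjoint u v (h.mem_closedNbhd_s9 hv) w (h.mem_closedNbhd_s9 hw) hvw).subset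
    ⟨hv, hw⟩

theorem exists_rts_eq (h : IsTPartitionSystem G P) : ∃ op : V → V → V, rts op = P := by
  choose op _ hop using h.cover
  refine ⟨op, funext fun u => funext fun v => Set.ext fun a => ⟨?_, h.eq_of_mem_s9 (hop u a)⟩⟩
  rintro rfl
  exact hop u a

theorem isOnGraph {op : V → V → V} (h : IsTPartitionSystem G (rts op)) : IsOnGraph op G :=
  fun u v => ⟨fun huv => ⟨huv.ne, (h.p1b u v huv.ne).2 huv⟩,
    fun huv => (h.p1b u v huv.1).1 huv.2⟩

theorem isTravelGroupoid {op : V → V → V} (h : IsTPartitionSystem G (rts op)) :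
    IsTravelGroupoid op := by
  refine ⟨fun u v => ?_, fun u v huv => ?_⟩
  · rcases h.mem_closedNbhd_s9 (show v ∈ rts op u (op u v) from rfl) with hu | hu
    · rw [hu]
      exact (h.p1a u).superset rfl
    · exact ((h.isOnGraph _ _).1 (G.adj_symm hu)).2
  · by_cases hu : u = op u v
    · exact ((h.p1a u).subset hu.symm).symm
    · exact ((h.p2 u _ hu).subset ⟨rfl, huv⟩).elim

end IsTPartitionSystem

theorem stmt9 [Nonempty V] (G : SimpleGraph V) :
    Set.BijOn (fun op : V → V → V => rts op)
      {op : V → V → V | (IsTravelGroupoid op ∧ T3 op) ∧ IsOnGraph op G}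
      {P : V → V → Set V | IsTPartitionSystem G P ∧ R3 P} := by
  refine ⟨?_, rts_injective.injOn, ?_⟩
  · rintro op ⟨⟨h, h3⟩, hG⟩
    exact ⟨h.isTPartitionSystem_rts hG, h3.r3_rts⟩
  · rintro P ⟨h, hR⟩
    obtain ⟨op, rfl⟩ := h.exists_rts_eq
    exact ⟨op, ⟨⟨h.isTravelGroupoid, h.isTravelGroupoid.t3_of_r3_rts h.isOnGraph hR⟩,
      h.isOnGraph⟩, rfl⟩
end

section
/- Let G be a simple graph and let (V,*) be a smooth travel groupoid on G. Then the right translation system of (V,*), given by V_{u,v} = {w ∈ V | u*w = v}, is a smooth T-partition system on G. -/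
variable {V : Type*}

theorem T1.op_op {op : V → V → V} (h : T1 op) (u v : V) : op u (op u v) = op u v := by
  simpa only [h u v] using h (op u v) u

theorem IsTravelGroupoid.op_self_s12 {op : V → V → V} (h : IsTravelGroupoid op) (u : V) :
    op u u = u :=
  h.2 (op u u) u (by rw [h.1 u u])

theorem IsTravelGroupoid.op_eq_left_iff_s12 {op : V → V → V} (h : IsTravelGroupoid op) {u v : V} :
    op u v = u ↔ v = u := by
  refine ⟨fun huv => (h.2 u v ?_).symm, fun huv => huv ▸ h.op_self_s12 v⟩
  rw [huv, huv]

theorem IsTravelGroupoid.isTPartitionSystem_rts_s12 {op : V → V → V} {G : SimpleGraph V}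
    (h : IsTravelGroupoid op) (hG : IsOnGraph op G) : IsTPartitionSystem G (rts op) where
  cover u a := by
    refine ⟨op u a, ?_, rfl⟩
    by_cases hu : u = op u a
    · exact Or.inl hu.symm
    · exact Or.inr ((hG _ _).2 ⟨hu, h.1.op_op u a⟩)
  pairwise_disjoint u v _ w _ hvw :=
    Set.eq_empty_of_forall_notMem fun _ ha => hvw (ha.1.symm.trans ha.2)
  p1a u := Set.ext fun _ => h.op_eq_left_iff_s12
  p1b u v huv := ((hG u v).trans (and_iff_right huv)).symm
  p1c u v huv := by
    rw [hG u v, and_iff_right huv]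
    refine ⟨fun he hv => he.subset hv, fun hv => Set.eq_empty_of_forall_notMem ?_⟩
    rintro a rfl
    exact hv (h.1.op_op u a)
  p2 u v huv := by
    refine Set.eq_empty_of_forall_notMem ?_
    rintro a ⟨rfl, ha⟩
    obtain rfl := h.2 u a ha
    exact huv (h.op_self_s12 u).symm

theorem T4.r4_rts {op : V → V → V} (h : T4 op) : R4 (rts op) := by
  rintro u v x y z hx hy rfl
  exact (h u x y (hx.trans hy.symm)).trans hx

theorem stmt12 [Nonempty V] (G : SimpleGraph V) (op : V → V → V)
    (hTG : IsTravelGroupoid op) (hT4 : T4 op) (hOn : IsOnGraph op G) :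
    IsTPartitionSystem G (rts op) ∧ R4 (rts op) :=
  ⟨hTG.isTPartitionSystem_rts_s12 hOn, hT4.r4_rts⟩
end
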